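/- arXiv:1707.06967 — 4 statements merged into one kernel-verified Lean document; each statement's English description precedes it below -/
import Mathlib

section
/- Let f : ℝ → ℂ be differentiable on [0, ∞) with derivative f', let M > 0 and a ∈ ℝ be such that f is of exponential order (M, a), let s : ℂ satisfy Re s > a, and suppose the Laplace transforms of f and of f' both exist at s. Then L[f'](s) = s * L[f](s) - f 0 (differentiation in the time domain). -/
open MeasureTheory Set

/-- The Laplace transform of `f : ℝ → ℂ` at `s : ℂ`. -/
noncomputable def laplace (f : ℝ → ℂ) (s : ℂ) : ℂ :=
  ∫ t in Set.Ioi (0 : ℝ), Complex.exp (-(s * t)) * f t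

/-- The Laplace transform of `f` exists at `s`. -/
def laplaceExists (f : ℝ → ℂ) (s : ℂ) : Prop :=
  MeasureTheory.IntegrableOn (fun t : ℝ => Complex.exp (-(s * t)) * f t) (Set.Ioi (0 : ℝ))

/-- `f` is of exponential order `(M, a)`. -/
def expOrder (f : ℝ → ℂ) (M a : ℝ) : Prop :=
  0 < M ∧ ∀ t : ℝ, 0 ≤ t → ‖f t‖ ≤ M * Real.exp (a * t)

/-- Differentiation in the time domain. -/
theorem laplace_deriv (f f' : ℝ → ℂ) (M a : ℝ) (s : ℂ)
    (hdiff : ∀ t ∈ Set.Ici (0 : ℝ), HasDerivAt f (f' t) t)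
    (hexp : expOrder f M a) (hs : a < s.re)
    (hf : laplaceExists f s) (hf' : laplaceExists f' s) :
    laplace f' s = s * laplace f s - f 0 := by
  have htendsto : Filter.Tendsto (fun t : ℝ => Complex.exp (-(s * t)) * f t) Filter.atTop
      (nhds 0) := by
    have hdecay : Filter.Tendsto (fun t : ℝ => M * Real.exp (-((s.re - a) * t))) Filter.atTop
        (nhds 0) := by
      simpa using (Real.tendsto_exp_neg_atTop_nhds_zero.comp
        (Filter.tendsto_id.const_mul_atTop (sub_pos.mpr hs))).const_mul M
    refine squeeze_zero_norm' ?_ hdecay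
    filter_upwards [Filter.eventually_ge_atTop (0 : ℝ)] with t ht
    calc ‖Complex.exp (-(s * t)) * f t‖ = Real.exp (-(s.re * t)) * ‖f t‖ := by
          simp [Complex.norm_exp]
      _ ≤ Real.exp (-(s.re * t)) * (M * Real.exp (a * t)) := by
          gcongr
          exact hexp.2 t ht
      _ = M * Real.exp (-((s.re - a) * t)) := by
          rw [mul_left_comm, ← Real.exp_add]
          ring_nf
  have hderiv : ∀ t ∈ Set.Ici (0 : ℝ), HasDerivAt (fun t : ℝ => Complex.exp (-(s * t)) * f t)
      (Complex.exp (-(s * t)) * f' t - s * (Complex.exp (-(s * t)) * f t)) t := by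
    intro t ht
    have hker : HasDerivAt (fun t : ℝ => Complex.exp (-(s * t)))
        (Complex.exp (-(s * t)) * -(s * 1)) t :=
      ((Complex.ofRealCLM.hasDerivAt (x := t)).const_mul s).neg.cexp
    exact (hker.mul (hdiff t ht)).congr_deriv (by ring)
  have hftc := integral_Ioi_of_hasDerivAt_of_tendsto' hderiv (hf'.sub (hf.const_mul s)) htendsto
  rw [integral_sub hf' (hf.const_mul s), integral_const_mul] at hftc
  simp only [Complex.ofReal_zero, mul_zero, neg_zero, Complex.exp_zero, one_mul, zero_sub] at hftc
  unfold laplace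
  linear_combination hftc
end

section
/- Let f : ℝ → ℂ be continuous on [0, ∞), define g t = ∫ τ in [0, t], f τ for t ≥ 0, let M > 0 and a ∈ ℝ be such that f is of exponential order (M, a), let s : ℂ satisfy Re s > max a 0 and s ≠ 0, and suppose the Laplace transforms of f and of g exist at s. Then L[g](s) = L[f](s) / s (integration in the time domain). -/
open MeasureTheory Set

/-- `L[h'](s) = s * L[h](s)` for a differentiable function `h` vanishing at `0`. -/
theorem laplace_of_hasDerivAt {h h' : ℝ → ℂ} {s : ℂ}
    (hderiv : ∀ t, 0 ≤ t → HasDerivAt h (h' t) t) (h0 : h 0 = 0)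
    (hint' : laplaceExists h' s) (hint : laplaceExists h s) :
    laplace h' s = s * laplace h s := by
  have hd : ∀ t ∈ Ici (0 : ℝ), HasDerivAt (fun t : ℝ => Complex.exp (-(s * t)) * h t)
      (Complex.exp (-(s * t)) * h' t - s * (Complex.exp (-(s * t)) * h t)) t := by
    intro t ht
    have he : HasDerivAt (fun t : ℝ => Complex.exp (-(s * t)))
        (Complex.exp (-(s * t)) * (-(s * 1))) t :=
      (((hasDerivAt_id (t : ℂ)).const_mul s).neg.cexp).comp_ofReal
    exact (he.mul (hderiv t ht)).congr_deriv (by ring)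
  have hi := Integrable.sub hint' (hint.const_mul s)
  have hlim := tendsto_zero_of_hasDerivAt_of_integrableOn_Ioi
    (fun t ht => hd t (Ioi_subset_Ici_self ht)) hi hint
  have key := integral_Ioi_of_hasDerivAt_of_tendsto' hd hi hlim
  rw [integral_sub hint' (hint.const_mul s), integral_const_mul, h0, mul_zero, sub_zero] at key
  exact sub_eq_zero.mp key

theorem laplace_congr {f g : ℝ → ℂ} (h : EqOn f g (Ioi 0)) (s : ℂ) : laplace f s = laplace g s :=
  setIntegral_congr_fun measurableSet_Ioi fun t ht => congrArg (Complex.exp (-(s * t)) * ·) (h ht)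

theorem laplaceExists.congr {f g : ℝ → ℂ} {s : ℂ} (hf : laplaceExists f s)
    (h : EqOn f g (Ioi 0)) : laplaceExists g s :=
  IntegrableOn.congr_fun hf (fun t ht => congrArg (Complex.exp (-(s * t)) * ·) (h ht))
    measurableSet_Ioi

/-- Integration in the time domain. -/
theorem laplace_integral (f g : ℝ → ℂ) (M a : ℝ) (s : ℂ)
    (hcont : ContinuousOn f (Set.Ici (0 : ℝ)))
    (hg : ∀ t : ℝ, 0 ≤ t → g t = ∫ τ in (0 : ℝ)..t, f τ)
    (hexp : expOrder f M a) (hs : max a 0 < s.re) (hs0 : s ≠ 0)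
    (hf : laplaceExists f s) (hglap : laplaceExists g s) :
    laplace g s = laplace f s / s := by
  -- Extend `f` to a continuous function on the whole line.
  set F : ℝ → ℂ := fun t => f (max 0 t) with hF
  have hFcont : Continuous F :=
    hcont.comp_continuous (continuous_const.max continuous_id) fun t => le_max_left 0 t
  have hfF : EqOn f F (Ici 0) := fun t ht => by simp only [hF, max_eq_right (mem_Ici.mp ht)]
  have hgF : EqOn g (fun t => ∫ τ in (0 : ℝ)..t, F τ) (Ioi 0) := fun t ht => by
    have ht0 : 0 ≤ t := le_of_lt ht
    rw [hg t ht0]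
    refine intervalIntegral.integral_congr fun τ hτ => hfF ?_
    rw [uIcc_of_le ht0] at hτ
    exact hτ.1
  have hfF' := hfF.mono Ioi_subset_Ici_self
  rw [eq_div_iff hs0, mul_comm, laplace_congr hfF', laplace_congr hgF]
  exact (laplace_of_hasDerivAt
    (fun t _ => hFcont.integral_hasStrictDerivAt 0 t |>.hasDerivAt)
    intervalIntegral.integral_same (hf.congr hfF') (hglap.congr hgF)).symm
end

section
/- Let f : ℝ → ℂ, s : ℂ, and t₀ > 0, suppose the Laplace transform of f exists at s, and define g : ℝ → ℂ by g t = f (t - t₀) if t ≥ t₀ and g t = 0 otherwise. Then the Laplace transform of g exists at s and L[g](s) = Complex.exp (-(s * t₀)) * L[f](s) (time shifting). -/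
open MeasureTheory Set

/-- Time shifting property of the Laplace transform. -/
theorem laplace_time_shift (f g : ℝ → ℂ) (s : ℂ) (t₀ : ℝ) (ht₀ : 0 < t₀)
    (hf : laplaceExists f s)
    (hg : ∀ t : ℝ, g t = if t₀ ≤ t then f (t - t₀) else 0) :
    laplaceExists g s ∧ laplace g s = Complex.exp (-(s * t₀)) * laplace f s := by
  set F : ℝ → ℂ := fun t => Complex.exp (-(s * t)) * f t with hF
  have key : (Ioi (0 : ℝ)).indicator (fun t : ℝ => Complex.exp (-(s * t)) * g t) =
      fun t => Complex.exp (-(s * t₀)) * (Ici (0 : ℝ)).indicator F (t - t₀) := by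
    funext t
    by_cases h : t₀ ≤ t
    · have h0 : t ∈ Ioi (0 : ℝ) := lt_of_lt_of_le ht₀ h
      have h1 : t - t₀ ∈ Ici (0 : ℝ) := sub_nonneg.mpr h
      rw [indicator_of_mem h0, indicator_of_mem h1, hg, if_pos h, hF]
      dsimp only
      rw [← mul_assoc, ← Complex.exp_add]
      congr 2
      push_cast
      ring
    · have h1 : t - t₀ ∉ Ici (0 : ℝ) := fun h' => h (sub_nonneg.mp h')
      rw [indicator_of_notMem h1, mul_zero]
      simp [indicator, hg, h]
  have hint : Integrable ((Ici (0 : ℝ)).indicator F) :=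
    (integrable_indicator_iff measurableSet_Ici).mpr ((integrableOn_congr_set_ae Ioi_ae_eq_Ici).mp hf)
  constructor
  · unfold laplaceExists
    rw [← integrable_indicator_iff measurableSet_Ioi, key]
    exact (hint.comp_sub_right t₀).const_mul _
  · unfold laplace
    rw [← integral_indicator measurableSet_Ioi, key, integral_const_mul,
      integral_sub_right_eq_self ((Ici (0 : ℝ)).indicator F) t₀,
      integral_indicator measurableSet_Ici, integral_Ici_eq_integral_Ioi]
end

section
/- Let R1, R2, C1, C2 be positive real numbers and let Vi, Vb, Vo : ℝ → ℂ be such that Vi is twice differentiable, Vb is twice differentiable, and Vo is differentiable on (0, ∞). Suppose that for all t > 0 the two Kirchhoff current law equations of the PID active realization hold with the node voltage Va identically zero: (C1 : ℂ) * Vi'(t) + Vi(t) / R1 + Vb(t) / R2 = 0, and -Vb(t) / R2 + (C2 : ℂ) * (Vo'(t) - Vb'(t)) = 0. Then for all t > 0 the behavioral specification of the PID controller holds: (R1 * C2 : ℂ) * Vo'(t) = -((R1 * R2 * C1 * C2 : ℂ) * Vi''(t) + (R2 * C2 + R1 * C1 : ℂ) * Vi'(t) + Vi(t)). -/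
/-- From the Kirchhoff current law implementation of the active PID realization (with the
virtual-ground condition `Va = 0`) to its behavioral (differential equation) specification. -/
theorem pid_implem_imp_behav_spec (R1 R2 C1 C2 : ℝ) (Vi Vb Vo : ℝ → ℂ)
    (hR1 : 0 < R1) (hR2 : 0 < R2) (hC1 : 0 < C1) (hC2 : 0 < C2)
    (hVi : ∀ t ∈ Set.Ioi (0 : ℝ), DifferentiableAt ℝ Vi t)
    (hVi' : ∀ t ∈ Set.Ioi (0 : ℝ), DifferentiableAt ℝ (deriv Vi) t)
    (hVb : ∀ t ∈ Set.Ioi (0 : ℝ), DifferentiableAt ℝ Vb t)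
    (hVb' : ∀ t ∈ Set.Ioi (0 : ℝ), DifferentiableAt ℝ (deriv Vb) t)
    (hVo : ∀ t ∈ Set.Ioi (0 : ℝ), DifferentiableAt ℝ Vo t)
    (hkcl_a : ∀ t : ℝ, 0 < t →
      (C1 : ℂ) * deriv Vi t + Vi t / (R1 : ℂ) + Vb t / (R2 : ℂ) = 0)
    (hkcl_b : ∀ t : ℝ, 0 < t →
      -(Vb t / (R2 : ℂ)) + (C2 : ℂ) * (deriv Vo t - deriv Vb t) = 0) :
    ∀ t : ℝ, 0 < t →
      ((R1 * C2 : ℝ) : ℂ) * deriv Vo t =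
        -(((R1 * R2 * C1 * C2 : ℝ) : ℂ) * deriv (deriv Vi) t +
          ((R2 * C2 + R1 * C1 : ℝ) : ℂ) * deriv Vi t + Vi t) := by
  intro t ht
  have hR1c : (R1 : ℂ) ≠ 0 := by exact_mod_cast hR1.ne'
  have hR2c : (R2 : ℂ) ≠ 0 := by exact_mod_cast hR2.ne'
  have hderiv_a : (C1 : ℂ) * deriv (deriv Vi) t + deriv Vi t / (R1 : ℂ) +
      deriv Vb t / (R2 : ℂ) = 0 := by
    have hsum := (((hVi' t ht).hasDerivAt.const_mul (C1 : ℂ)).add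
      ((hVi t ht).hasDerivAt.div_const (R1 : ℂ))).add
      ((hVb t ht).hasDerivAt.div_const (R2 : ℂ))
    have hzero : HasDerivAt (fun _ : ℝ => (0 : ℂ)) _ t :=
      hsum.congr_of_eventuallyEq <| by
        filter_upwards [Ioi_mem_nhds ht] with s hs
        exact (hkcl_a s hs).symm
    exact hzero.unique (hasDerivAt_const t 0)
  have ha := hkcl_a t ht
  have hb := hkcl_b t ht
  push_cast
  field_simp at ha hb hderiv_a
  apply mul_left_cancel₀ hR2c
  linear_combination (R1 : ℂ) * hb + (R2 : ℂ) * C2 * hderiv_a + ha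
end
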